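/- arXiv:1707.00476 — 2 statements merged into one kernel-verified Lean document; each statement's English description precedes it below -/
import Mathlib

section
/- Let S ⊆ ℝ^d be bounded, measurable, and of positive volume. Then the expected packing density α_S(λ) is a strictly increasing function of λ on (0, ∞): if 0 < λ₁ < λ₂ then α_S(λ₁) < α_S(λ₂). -/
open MeasureTheory Filter

/-- `rd d` is the radius of a Euclidean ball of volume 1 in `ℝ^d`. -/
noncomputable def rd (d : ℕ) : ℝ :=
  ((volume (Metric.closedBall (0 : EuclideanSpace ℝ (Fin d)) 1)).toReal) ^ (-(1 : ℝ) / d)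

/-- The set of `k`-tuples of points of `S` with pairwise distances `> 2 r_d`,
i.e. centers of packings by balls of volume 1. -/
def packSet (d k : ℕ) (S : Set (EuclideanSpace ℝ (Fin d))) :
    Set (Fin k → EuclideanSpace ℝ (Fin d)) :=
  {x | (∀ i, x i ∈ S) ∧ ∀ i j, i ≠ j → dist (x i) (x j) > 2 * rd d}

/-- The canonical hard sphere partition function `Ẑ_S(k)`. -/
noncomputable def Zhat (d : ℕ) (S : Set (EuclideanSpace ℝ (Fin d))) (k : ℕ) : ℝ :=
  (1 / (Nat.factorial k : ℝ)) *
    ∫ x : Fin k → EuclideanSpace ℝ (Fin d),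
      Set.indicator (packSet d k S) (fun _ => (1 : ℝ)) x

/-- The grand canonical hard sphere partition function `Z_S(λ)`. -/
noncomputable def Zgc (d : ℕ) (S : Set (EuclideanSpace ℝ (Fin d))) (lam : ℝ) : ℝ :=
  ∑' k : ℕ, lam ^ k * Zhat d S k

/-- The expected packing density `α_S(λ)` of the hard sphere model. -/
noncomputable def alphaS (d : ℕ) (S : Set (EuclideanSpace ℝ (Fin d))) (lam : ℝ) : ℝ :=
  (∑' k : ℕ, (k : ℝ) * lam ^ k * Zhat d S k) / ((volume S).toReal * Zgc d S lam)

/-- `Bn d n` is the closed ball of volume `n` centered at the origin in `ℝ^d`. -/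
noncomputable def Bn (d : ℕ) (n : ℝ) : Set (EuclideanSpace ℝ (Fin d)) :=
  Metric.closedBall 0 (n ^ ((1 : ℝ) / d) * rd d)

/-- The maximum number of centers of a packing of `B_n` by balls of volume 1. -/
noncomputable def Md (d : ℕ) (n : ℝ) : ℝ :=
  sSup {m : ℝ | ∃ X : Finset (EuclideanSpace ℝ (Fin d)),
    (∀ x ∈ X, x ∈ Bn d n) ∧ (∀ x ∈ X, ∀ y ∈ X, x ≠ y → dist x y > 2 * rd d) ∧
    m = (X.card : ℝ)}

/-- The externally uncovered region `T(v,X)` for a configuration `X = (x_1,…,x_k)`. -/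
def Treg (d : ℕ) (S : Set (EuclideanSpace ℝ (Fin d))) (v : EuclideanSpace ℝ (Fin d))
    {k : ℕ} (x : Fin k → EuclideanSpace ℝ (Fin d)) : Set (EuclideanSpace ℝ (Fin d)) :=
  {p | p ∈ Metric.closedBall v (2 * rd d) ∩ S ∧
    ∀ i, dist (x i) v > 2 * rd d → dist p (x i) > 2 * rd d}

/-- The expectation of a functional `g(v, X)` under the two-part experiment:
`X` drawn from the hard sphere model on `S` at fugacity `λ`, and independently
`v` uniform in `S`. -/
noncomputable def ExpT (d : ℕ) (S : Set (EuclideanSpace ℝ (Fin d))) (lam : ℝ)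
    (g : EuclideanSpace ℝ (Fin d) → ∀ k : ℕ, (Fin k → EuclideanSpace ℝ (Fin d)) → ℝ) : ℝ :=
  (1 / ((volume S).toReal * Zgc d S lam)) *
    ∑' k : ℕ, (lam ^ k / (Nat.factorial k : ℝ)) *
      ∫ v in S, ∫ x : Fin k → EuclideanSpace ℝ (Fin d),
        Set.indicator (packSet d k S) (fun y => g v k y) x

theorem packSet_measurable (d k : ℕ) (S : Set (EuclideanSpace ℝ (Fin d)))
    (hM : MeasurableSet S) : MeasurableSet (packSet d k S) := by
  unfold packSet
  refine MeasurableSet.inter ?_ ?_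
  · have : {x : Fin k → EuclideanSpace ℝ (Fin d) | ∀ i, x i ∈ S}
        = ⋂ i, (fun x : Fin k → EuclideanSpace ℝ (Fin d) => x i) ⁻¹' S := by
      ext x; simp
    change MeasurableSet {x : Fin k → EuclideanSpace ℝ (Fin d) | ∀ i, x i ∈ S}
    rw [this]
    exact MeasurableSet.iInter (fun i => (measurable_pi_apply i) hM)
  · have : {x : Fin k → EuclideanSpace ℝ (Fin d) |
          ∀ i j, i ≠ j → dist (x i) (x j) > 2 * rd d}
        = ⋂ i, ⋂ j, ⋂ (_ : i ≠ j), {x | 2 * rd d < dist (x i) (x j)} := by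
      ext x; simp
    change MeasurableSet {x : Fin k → EuclideanSpace ℝ (Fin d) |
          ∀ i j, i ≠ j → dist (x i) (x j) > 2 * rd d}
    rw [this]
    refine MeasurableSet.iInter (fun i => MeasurableSet.iInter fun j =>
      MeasurableSet.iInter fun _ => ?_)
    exact measurableSet_lt measurable_const
      ((measurable_pi_apply i).dist (measurable_pi_apply j))

theorem Zhat_eq (d k : ℕ) (S : Set (EuclideanSpace ℝ (Fin d))) (hM : MeasurableSet S) :
    Zhat d S k = (1 / (Nat.factorial k : ℝ)) * (volume (packSet d k S)).toReal := by
  unfold Zhat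
  congr 1
  rw [integral_indicator (packSet_measurable d k S hM)]
  simp [Measure.real]

theorem packSet_subset (d k : ℕ) (S : Set (EuclideanSpace ℝ (Fin d))) :
    packSet d k S ⊆ Set.univ.pi (fun _ => S) := fun _ hx i _ => hx.1 i

theorem packSet_eq (d k : ℕ) (hk : k ≤ 1) (S : Set (EuclideanSpace ℝ (Fin d))) :
    packSet d k S = Set.univ.pi (fun _ => S) := by
  refine (packSet_subset d k S).antisymm (fun x hx => ⟨fun i => hx i trivial, fun i j h => ?_⟩)
  exact absurd (Fin.ext (by omega)) h

theorem vol_pi (d k : ℕ) (S : Set (EuclideanSpace ℝ (Fin d))) :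
    volume (Set.univ.pi (fun _ : Fin k => S)) = volume S ^ k := by
  rw [volume_pi_pi]; simp

theorem ratio_aux (a : ℕ → ℝ) (V : ℝ) (ha : ∀ k, 0 ≤ a k)
    (hb : ∀ k, a k ≤ V ^ k / (Nat.factorial k : ℝ)) (h0 : 0 < a 0) (h1 : 0 < a 1)
    (x y : ℝ) (hx : 0 < x) (hxy : x < y) :
    0 < ∑' k : ℕ, x ^ k * a k ∧ 0 < ∑' k : ℕ, y ^ k * a k ∧
    (∑' k : ℕ, (k : ℝ) * x ^ k * a k) * (∑' k : ℕ, y ^ k * a k) <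
    (∑' k : ℕ, (k : ℝ) * y ^ k * a k) * (∑' k : ℕ, x ^ k * a k) := by
  have hy : 0 < y := hx.trans hxy
  have s1 : ∀ z : ℝ, 0 < z → Summable (fun k : ℕ => (k : ℝ) * z ^ k * a k) := by
    intro z hz
    refine Summable.of_nonneg_of_le (fun k => by have := ha k; positivity) (fun k => ?_)
      (Real.summable_pow_div_factorial (2 * z * V))
    have hk : (k : ℝ) ≤ 2 ^ k := by exact_mod_cast Nat.lt_two_pow_self.le
    calc (k : ℝ) * z ^ k * a k ≤ 2 ^ k * z ^ k * (V ^ k / (Nat.factorial k : ℝ)) := by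
          have := ha k; have := hb k; gcongr
      _ = _ := by rw [mul_pow, mul_pow]; ring
  have s0 : ∀ z : ℝ, 0 < z → Summable (fun k : ℕ => z ^ k * a k) := by
    intro z hz
    refine Summable.of_nonneg_of_le (fun k => by have := ha k; positivity) (fun k => ?_)
      (Real.summable_pow_div_factorial (z * V))
    calc z ^ k * a k ≤ z ^ k * (V ^ k / (Nat.factorial k : ℝ)) := by
          have := hb k; gcongr
      _ = _ := by rw [mul_pow]; ring
  have p0 : ∀ z : ℝ, 0 < z → 0 < ∑' k : ℕ, z ^ k * a k := fun z hz =>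
    (s0 z hz).tsum_pos (fun k => by have := ha k; positivity) 0 (by simpa using h0)
  refine ⟨p0 x hx, p0 y hy, ?_⟩
  have n0 : ∀ z : ℝ, 0 < z → 0 ≤ (fun k : ℕ => z ^ k * a k) := fun z hz k => by
    have := ha k; show 0 ≤ z ^ k * a k; positivity
  have n1 : ∀ z : ℝ, 0 < z → 0 ≤ (fun k : ℕ => (k : ℝ) * z ^ k * a k) := fun z hz k => by
    have := ha k; show 0 ≤ (k : ℝ) * z ^ k * a k; positivity
  have sA := (s1 y hy).mul_of_nonneg (s0 x hx) (n1 y hy) (n0 x hx)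
  have sB := (s1 x hx).mul_of_nonneg (s0 y hy) (n1 x hx) (n0 y hy)
  rw [(s1 y hy).tsum_mul_tsum (s0 x hx) sA, (s1 x hx).tsum_mul_tsum (s0 y hy) sB]
  have sf := sA.sub sB
  have sg := (Equiv.prodComm ℕ ℕ).summable_iff.mpr sf
  have key := (sf.add sg).tsum_pos (i := (1, 0)) ?_ ?_
  · have hc := (Equiv.prodComm ℕ ℕ).tsum_eq
      (fun p : ℕ × ℕ => (p.1 : ℝ) * y ^ p.1 * a p.1 * (x ^ p.2 * a p.2)
        - (p.1 : ℝ) * x ^ p.1 * a p.1 * (y ^ p.2 * a p.2))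
    rw [sf.tsum_add sg] at key
    simp only [Function.comp_def] at key
    rw [hc, sA.tsum_sub sB] at key
    linarith
  · rintro ⟨j, k⟩
    simp only [Function.comp, Equiv.prodComm_apply, Prod.swap]
    have hyx : ∀ m n : ℕ, m ≤ n → x ^ n * y ^ m ≤ y ^ n * x ^ m := by
      intro m n h
      obtain ⟨c, rfl⟩ := Nat.exists_eq_add_of_le h
      have : x ^ c ≤ y ^ c := by gcongr
      have h2 : 0 ≤ x ^ m * y ^ m := by positivity
      rw [pow_add, pow_add]; nlinarith
    have e : (j : ℝ) * y ^ j * a j * (x ^ k * a k) - (j : ℝ) * x ^ j * a j * (y ^ k * a k)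
        + ((k : ℝ) * y ^ k * a k * (x ^ j * a j) - (k : ℝ) * x ^ k * a k * (y ^ j * a j))
        = a j * a k * (((j : ℝ) - k) * (y ^ j * x ^ k - x ^ j * y ^ k)) := by ring
    rw [e]
    refine mul_nonneg (mul_nonneg (ha j) (ha k)) ?_
    rcases le_total k j with h | h
    · exact mul_nonneg (sub_nonneg.2 (by exact_mod_cast h)) (sub_nonneg.2 (hyx k j h))
    · refine mul_nonneg_of_nonpos_of_nonpos (sub_nonpos.2 (by exact_mod_cast h)) ?_
      have := hyx j k h
      linarith
  · simp
    have : 0 < a 1 * a 0 := by positivity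
    nlinarith

/-- the expected packing density `α_S(λ)` is strictly increasing in `λ` on
`(0, ∞)`. -/
theorem alphaS_strictMono (d : ℕ) (S : Set (EuclideanSpace ℝ (Fin d)))
    (hB : Bornology.IsBounded S) (hM : MeasurableSet S) (hv : 0 < volume S) :
    ∀ lam₁ lam₂ : ℝ, 0 < lam₁ → lam₁ < lam₂ → alphaS d S lam₁ < alphaS d S lam₂ := by
  intro x y hx hxy
  have hfin : volume S ≠ ⊤ := hB.measure_lt_top.ne
  have hV : 0 < (volume S).toReal := ENNReal.toReal_pos hv.ne' hfin
  obtain ⟨px, py, h⟩ := ratio_aux (Zhat d S) (volume S).toReal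
    (fun k => by rw [Zhat_eq d k S hM]; positivity)
    (fun k => by
      rw [Zhat_eq d k S hM, one_div, div_eq_inv_mul]
      gcongr
      rw [← ENNReal.toReal_pow, ← vol_pi]
      refine ENNReal.toReal_mono ?_ (measure_mono (packSet_subset d k S))
      rw [vol_pi]; exact ENNReal.pow_ne_top hfin)
    (by rw [Zhat_eq d _ S hM, packSet_eq d _ (by norm_num), vol_pi]; simp)
    (by rw [Zhat_eq d _ S hM, packSet_eq d _ (by norm_num), vol_pi]; simpa using hV)
    x y hx hxy
  unfold alphaS Zgc
  rw [div_lt_div_iff₀ (mul_pos hV px) (mul_pos hV py)]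
  nlinarith
end

section
/- Let S ⊆ ℝ^d be bounded, measurable, and of positive volume, and let λ > 0. Then α_S(λ) ≥ 2^{-d} · E[ (Σ_{k≥1} k λ^k Ẑ_{T(v,X)}(k)) / Z_{T(v,X)}(λ) ] (the quantity inside the expectation being λ Z'_{T}(λ)/Z_{T}(λ) = vol(T) · α_{T}(λ) for T = T(v,X)), where the expectation is over the two-part experiment in which a configuration X is drawn from the hard sphere model on S at fugacity λ and, independently, v is a uniform point of S, and T(v,X) is the externally uncovered region. -/
open MeasureTheory Filter

abbrev EE (d : ℕ) := EuclideanSpace ℝ (Fin d)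

/-- packings indexed by an arbitrary type -/
def pkG {d : ℕ} {ι : Type} (R : ℝ) (S : Set (EE d)) : Set (ι → EE d) :=
  {x | (∀ i, x i ∈ S) ∧ ∀ i j, i ≠ j → dist (x i) (x j) > R}

/-- externally uncovered region, arbitrary index type -/
def TgG {d : ℕ} {ι : Type} (R : ℝ) (S : Set (EE d)) (v : EE d) (x : ι → EE d) : Set (EE d) :=
  {p | p ∈ Metric.closedBall v R ∩ S ∧ ∀ i, dist (x i) v > R → dist p (x i) > R}

/-- external part of `S` -/
def CxG {d : ℕ} (R : ℝ) (S : Set (EE d)) (v : EE d) : Set (EE d) :=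
  {p | p ∈ S ∧ dist p v > R}

noncomputable def VV {d : ℕ} (R : ℝ) (j : ℕ) (T : Set (EE d)) : ENNReal :=
  volume (pkG (ι := Fin j) R T)

lemma measurableSet_pkG {d : ℕ} {ι : Type} [Fintype ι] (R : ℝ) {S : Set (EE d)}
    (hS : MeasurableSet S) : MeasurableSet (pkG (ι := ι) R S) := by
  have h1 : ∀ i, MeasurableSet {x : ι → EE d | x i ∈ S} := fun i => measurable_pi_apply i hS
  have h2 : ∀ i j, MeasurableSet {x : ι → EE d | R < dist (x i) (x j)} := fun i j =>
    measurableSet_lt measurable_const (by fun_prop)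
  convert (MeasurableSet.iInter h1).inter (MeasurableSet.iInter fun i => MeasurableSet.iInter fun j =>
    MeasurableSet.iInter fun _ : i ≠ j => h2 i j) using 1
  ext x
  simp [pkG]

lemma measurableSet_CxG {d : ℕ} (R : ℝ) {S : Set (EE d)} (v : EE d)
    (hS : MeasurableSet S) : MeasurableSet (CxG R S v) := by
  have h : MeasurableSet {p : EE d | R < dist p v} := measurableSet_lt measurable_const (by fun_prop)
  exact hS.inter h

lemma measurableSet_TgG_joint {d : ℕ} {ι : Type} [Fintype ι] (R : ℝ) {S : Set (EE d)}
    (hS : MeasurableSet S) :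
    MeasurableSet {q : (EE d × (ι → EE d)) × EE d | q.2 ∈ TgG R S q.1.1 q.1.2} := by
  have h1 : MeasurableSet {q : (EE d × (ι → EE d)) × EE d | dist q.2 q.1.1 ≤ R} :=
    measurableSet_le (by fun_prop) measurable_const
  have h2 : MeasurableSet {q : (EE d × (ι → EE d)) × EE d | q.2 ∈ S} :=
    measurable_snd hS
  have h3 : ∀ i, MeasurableSet {q : (EE d × (ι → EE d)) × EE d | R < dist (q.1.2 i) q.1.1} := fun i =>
    measurableSet_lt measurable_const (by fun_prop)
  have h4 : ∀ i, MeasurableSet {q : (EE d × (ι → EE d)) × EE d | R < dist q.2 (q.1.2 i)} := fun i =>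
    measurableSet_lt measurable_const (by fun_prop)
  convert (h1.inter h2).inter (MeasurableSet.iInter fun i => (h3 i).compl.union (h4 i)) using 1
  ext q
  simp [TgG, imp_iff_not_or]

lemma measurableSet_pk_joint {d : ℕ} {ι κ : Type} [Fintype ι] [Fintype κ] (R : ℝ) {S : Set (EE d)}
    (hS : MeasurableSet S) :
    MeasurableSet {q : (EE d × (ι → EE d)) × (κ → EE d) | q.2 ∈ pkG R (TgG R S q.1.1 q.1.2)} := by
  have h1 : ∀ i, MeasurableSet {q : (EE d × (ι → EE d)) × (κ → EE d) |
      q.2 i ∈ TgG R S q.1.1 q.1.2} := fun i => by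
    have h : Measurable (fun q : (EE d × (ι → EE d)) × (κ → EE d) => (q.1, q.2 i)) :=
      measurable_fst.prodMk ((measurable_pi_apply i).comp measurable_snd)
    have := h (measurableSet_TgG_joint R hS)
    exact this
  have h2 : ∀ i j, MeasurableSet {q : (EE d × (ι → EE d)) × (κ → EE d) |
      R < dist (q.2 i) (q.2 j)} := fun i j =>
    measurableSet_lt measurable_const (by fun_prop)
  convert (MeasurableSet.iInter h1).inter (MeasurableSet.iInter fun i => MeasurableSet.iInter fun j =>
    MeasurableSet.iInter fun _ : i ≠ j => h2 i j) using 1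
  ext x
  simp [pkG]

lemma measurableSet_TgG {d : ℕ} {ι : Type} [Fintype ι] (R : ℝ) {S : Set (EE d)}
    (hS : MeasurableSet S) (v : EE d) (x : ι → EE d) : MeasurableSet (TgG R S v x) := by
  have h : Measurable (fun p : EE d => ((v, x), p)) := measurable_prodMk_left
  have := h (measurableSet_TgG_joint (ι := ι) R hS)
  exact this

lemma measurable_VV_joint {d : ℕ} {ι : Type} [Fintype ι] (R : ℝ) {S : Set (EE d)}
    (hS : MeasurableSet S) (j : ℕ) :
    Measurable (fun q : EE d × (ι → EE d) => VV R j (TgG R S q.1 q.2)) :=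
  measurable_measure_prodMk_left (measurableSet_pk_joint (κ := Fin j) R hS)

lemma measurable_VV {d : ℕ} {ι : Type} [Fintype ι] (R : ℝ) {S : Set (EE d)}
    (hS : MeasurableSet S) (j : ℕ) (v : EE d) :
    Measurable (fun x : ι → EE d => VV R j (TgG R S v x)) := by
  have h1 : Measurable (fun x : ι → EE d => (v, x)) := measurable_prodMk_left
  have h2 := (measurable_VV_joint (ι := ι) R hS j).comp h1
  simp only [Function.comp_def] at h2
  exact h2

/-- reindexing of integrals -/
lemma lintegral_reindex {d : ℕ} {ι κ : Type} [Fintype ι] [Fintype κ] (e : κ ≃ ι)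
    (f : (κ → EE d) → ENNReal) :
    ∫⁻ x : ι → EE d, f (fun k => x (e k)) = ∫⁻ y : κ → EE d, f y := by
  have hp := volume_measurePreserving_piCongrLeft (fun _ : ι => EE d) e
  rw [← hp.lintegral_comp_emb (MeasurableEquiv.measurableEmbedding _)]
  congr 1
  ext y
  congr 1
  ext1 k
  simp [MeasurableEquiv.piCongrLeft, Equiv.piCongrLeft_apply_apply]

lemma pkG_reindex {d : ℕ} {ι κ : Type} (e : κ ≃ ι) (R : ℝ) (S : Set (EE d)) (x : ι → EE d) :
    (fun k => x (e k)) ∈ pkG R S ↔ x ∈ pkG R S := by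
  constructor
  · rintro ⟨h1, h2⟩
    refine ⟨fun i => by simpa using h1 (e.symm i), fun i j hij => ?_⟩
    simpa using h2 (e.symm i) (e.symm j) (by simpa using hij)
  · rintro ⟨h1, h2⟩
    exact ⟨fun i => h1 _, fun i j hij => h2 _ _ (by simpa using hij)⟩

lemma TgG_reindex {d : ℕ} {ι κ : Type} (e : κ ≃ ι) (R : ℝ) (S : Set (EE d)) (v : EE d)
    (x : ι → EE d) : TgG R S v (fun k => x (e k)) = TgG R S v x := by
  ext p
  simp only [TgG, Set.mem_ofPred_eq]
  refine and_congr_right fun _ => ?_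
  exact ⟨fun h i => by simpa using h (e.symm i), fun h k => h _⟩

lemma volume_pkG {d : ℕ} {κ : Type} [Fintype κ] (R : ℝ) {T : Set (EE d)} (hT : MeasurableSet T)
    {j : ℕ} (hj : Fintype.card κ = j) : volume (pkG (ι := κ) R T) = VV R j T := by
  classical
  have e : Fin j ≃ κ := (Fintype.equivFinOfCardEq hj).symm
  unfold VV
  rw [← lintegral_indicator_one (measurableSet_pkG R hT),
    ← lintegral_indicator_one (measurableSet_pkG R hT), ← lintegral_reindex e]
  congr 1
  ext x
  simp only [Set.indicator, pkG_reindex e]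
  rfl

/-- the set-theoretic splitting -/
lemma split_iff {d : ℕ} {ι : Type} [Fintype ι] (R : ℝ) (S : Set (EE d)) (v : EE d)
    (A : Finset ι) (x : ι → EE d) :
    (x ∈ pkG R S ∧ ∀ i, i ∈ A ↔ dist (x i) v > R) ↔
    ((fun a : {i // i ∈ A} => x a) ∈ pkG R (CxG R S v) ∧
      (fun b : {i // ¬ i ∈ A} => x b) ∈ pkG R (TgG R S v (fun a : {i // i ∈ A} => x a))) := by
  constructor
  · rintro ⟨⟨h1, h2⟩, h3⟩
    refine ⟨⟨fun a => ⟨h1 _, (h3 _).1 a.2⟩, fun i j hij => h2 _ _ (fun H => hij (Subtype.ext H))⟩,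
      ⟨fun b => ⟨⟨?_, h1 _⟩, fun a _ => h2 _ _ ?_⟩, fun i j hij => h2 _ _ (fun H => hij (Subtype.ext H))⟩⟩
    · have := (h3 b).not.1 b.2
      simpa using this
    · intro h
      exact b.2 (h ▸ a.2)
  · rintro ⟨⟨h1, h2⟩, ⟨h3, h4⟩⟩
    refine ⟨⟨fun i => ?_, fun i j hij => ?_⟩, fun i => ?_⟩
    · by_cases hi : i ∈ A
      · exact (h1 ⟨i, hi⟩).1
      · exact (h3 ⟨i, hi⟩).1.2
    · by_cases hi : i ∈ A <;> by_cases hj : j ∈ A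
      · exact h2 ⟨i, hi⟩ ⟨j, hj⟩ (fun H => hij (congrArg Subtype.val H))
      · rw [dist_comm]
        exact (h3 ⟨j, hj⟩).2 ⟨i, hi⟩ (h1 ⟨i, hi⟩).2
      · exact (h3 ⟨i, hi⟩).2 ⟨j, hj⟩ (h1 ⟨j, hj⟩).2
      · exact h4 ⟨i, hi⟩ ⟨j, hj⟩ (fun H => hij (congrArg Subtype.val H))
    · by_cases hi : i ∈ A
      · exact iff_of_true hi (h1 ⟨i, hi⟩).2
      · refine iff_of_false hi ?_
        have := (h3 ⟨i, hi⟩).1.1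
        simpa using this

lemma TgG_split {d : ℕ} {ι : Type} (R : ℝ) (S : Set (EE d)) (v : EE d)
    (A : Finset ι) (x : ι → EE d) (h : ∀ i, i ∈ A ↔ dist (x i) v > R) :
    TgG R S v x = TgG R S v (fun a : {i // i ∈ A} => x a) := by
  ext p
  simp only [TgG, Set.mem_ofPred_eq]
  refine and_congr_right fun _ => ?_
  exact ⟨fun H a => H a, fun H i hi => H ⟨i, (h i).2 hi⟩ hi⟩

open Classical in
/-- number of internal points -/
noncomputable def nin {d : ℕ} {ι : Type} [Fintype ι] (R : ℝ) (v : EE d) (x : ι → EE d) : ℕ :=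
  (Finset.univ.filter fun i => ¬ dist (x i) v > R).card

/-- the product kernel -/
noncomputable def KK {d : ℕ} (R : ℝ) (S : Set (EE d)) (v : EE d) (h : ℕ → Set (EE d) → ENNReal)
    (m j : ℕ) : ENNReal :=
  ∫⁻ y : Fin m → EE d, (pkG R (CxG R S v)).indicator
    (fun y => h j (TgG R S v y) * VV R j (TgG R S v y)) y

open Classical in
lemma term_eq {d : ℕ} {ι : Type} [Fintype ι] (R : ℝ) {S : Set (EE d)} (hS : MeasurableSet S)
    (v : EE d) (h : ℕ → Set (EE d) → ENNReal)
    (hh : ∀ (κ : Type) [Fintype κ] (j : ℕ), Measurable fun y : κ → EE d => h j (TgG R S v y))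
    (A : Finset ι) :
    ∫⁻ x : ι → EE d, (pkG R S ∩ {x | ∀ i, i ∈ A ↔ dist (x i) v > R}).indicator
      (fun x => h (nin R v x) (TgG R S v x)) x =
    KK R S v h A.card (Fintype.card ι - A.card) := by
  have hc : Fintype.card {i // ¬ i ∈ A} = Fintype.card ι - A.card := by
    rw [Fintype.card_subtype_compl]; simp
  set j := Fintype.card ι - A.card with hj
  have hp := volume_preserving_piEquivPiSubtypeProd (fun _ : ι => EE d) (fun i => i ∈ A)
  let F : ({i // i ∈ A} → EE d) × ({i // ¬ i ∈ A} → EE d) → ENNReal := fun q =>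
    (pkG R (CxG R S v)).indicator (fun y => h j (TgG R S v y)) q.1 *
      {q : ({i // i ∈ A} → EE d) × ({i // ¬ i ∈ A} → EE d) |
        q.2 ∈ pkG R (TgG R S v q.1)}.indicator 1 q
  have hms : MeasurableSet {q : ({i // i ∈ A} → EE d) × ({i // ¬ i ∈ A} → EE d) |
        q.2 ∈ pkG R (TgG R S v q.1)} := by
    have hm : Measurable (fun q : ({i // i ∈ A} → EE d) × ({i // ¬ i ∈ A} → EE d) =>
      ((v, q.1), q.2)) := (measurable_const.prodMk measurable_fst).prodMk measurable_snd
    have := hm (measurableSet_pk_joint (ι := {i // i ∈ A}) (κ := {i // ¬ i ∈ A}) R hS)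
    exact this
  have hm1 : Measurable ((pkG R (CxG R S v)).indicator
      (fun y : {i // i ∈ A} → EE d => h j (TgG R S v y))) :=
    (hh _ j).indicator (measurableSet_pkG R (measurableSet_CxG R v hS))
  have hF : Measurable F :=
    (hm1.comp measurable_fst).mul ((measurable_const (a := (1 : ENNReal))).indicator hms)
  have e1 : ∀ x : ι → EE d, (pkG R S ∩ {x | ∀ i, i ∈ A ↔ dist (x i) v > R}).indicator
      (fun x => h (nin R v x) (TgG R S v x)) x =
      F (MeasurableEquiv.piEquivPiSubtypeProd (fun _ : ι => EE d) (fun i => i ∈ A) x) := by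
    intro x
    have hs := split_iff R S v A x
    by_cases hx : x ∈ pkG R S ∧ ∀ i, i ∈ A ↔ dist (x i) v > R
    · obtain ⟨hy, hz⟩ := hs.1 hx
      rw [Set.indicator_of_mem (by exact hx)]
      have hn : nin R v x = j := by
        unfold nin
        rw [← hc, Fintype.card_subtype]
        congr 1
        ext i
        simp [hx.2 i]
      rw [hn, TgG_split R S v A x hx.2]
      show _ = (pkG R (CxG R S v)).indicator (fun y => h j (TgG R S v y))
        (fun a : {i // i ∈ A} => x a) * Set.indicator _ 1
          ((fun a : {i // i ∈ A} => x a), (fun a : {i // ¬ i ∈ A} => x a))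
      rw [Set.indicator_of_mem hy, Set.indicator_of_mem (by exact hz)]
      simp
    · rw [Set.indicator_of_notMem (by exact hx)]
      rw [hs] at hx
      show _ = (pkG R (CxG R S v)).indicator (fun y => h j (TgG R S v y))
        (fun a : {i // i ∈ A} => x a) * Set.indicator _ 1
          ((fun a : {i // i ∈ A} => x a), (fun a : {i // ¬ i ∈ A} => x a))
      by_cases hy : (fun a : {i // i ∈ A} => x a) ∈ pkG R (CxG R S v)
      · rw [Set.indicator_of_notMem (s := {q : ({i // i ∈ A} → EE d) × ({i // ¬ i ∈ A} → EE d) |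
          q.2 ∈ pkG R (TgG R S v q.1)}) (by
            intro hz; exact hx ⟨hy, hz⟩), mul_zero]
      · rw [Set.indicator_of_notMem hy, zero_mul]
  rw [lintegral_congr e1, hp.lintegral_comp_emb (MeasurableEquiv.measurableEmbedding _)]
  rw [Measure.volume_eq_prod, lintegral_prod _ hF.aemeasurable]
  have e2 : ∀ y : {i // i ∈ A} → EE d, ∫⁻ z : {i // ¬ i ∈ A} → EE d, F (y, z) =
      (pkG R (CxG R S v)).indicator (fun y => h j (TgG R S v y) * VV R j (TgG R S v y)) y := by
    intro y
    show ∫⁻ z : {i // ¬ i ∈ A} → EE d, (pkG R (CxG R S v)).indicator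
      (fun y => h j (TgG R S v y)) y * (pkG R (TgG R S v y)).indicator 1 z = _
    have hmp := measurableSet_pkG (ι := {i // ¬ i ∈ A}) R (measurableSet_TgG R hS v y)
    have hmi : Measurable ((pkG R (TgG R S v y)).indicator
        (1 : ({i // ¬ i ∈ A} → EE d) → ENNReal)) := measurable_one.indicator hmp
    rw [lintegral_const_mul _ hmi,
      lintegral_indicator_one hmp, volume_pkG R (measurableSet_TgG R hS v y) hc]
    by_cases hy : y ∈ pkG R (CxG R S v)
    · simp [hy]
    · simp [hy]
  rw [lintegral_congr e2]
  have e : Fin A.card ≃ {i // i ∈ A} := (Fintype.equivFinOfCardEq (by simp)).symm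
  unfold KK
  rw [← lintegral_reindex e ((pkG R (CxG R S v)).indicator
    (fun y => h j (TgG R S v y) * VV R j (TgG R S v y)))]
  have e4 : ∀ y : {i // i ∈ A} → EE d, (pkG R (CxG R S v)).indicator
      (fun y => h j (TgG R S v y) * VV R j (TgG R S v y)) (fun k => y (e k)) =
      (pkG R (CxG R S v)).indicator (fun y => h j (TgG R S v y) * VV R j (TgG R S v y)) y := by
    intro y
    simp only [Set.indicator, pkG_reindex e, TgG_reindex e]
  rw [lintegral_congr e4]
  congr!

open Classical in
lemma JJ_eq {d : ℕ} (k : ℕ) (R : ℝ) {S : Set (EE d)} (hS : MeasurableSet S)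
    (v : EE d) (h : ℕ → Set (EE d) → ENNReal)
    (hh : ∀ (κ : Type) [Fintype κ] (j : ℕ), Measurable fun y : κ → EE d => h j (TgG R S v y)) :
    ∫⁻ x : Fin k → EE d, (pkG R S).indicator (fun x => h (nin R v x) (TgG R S v x)) x =
    ∑ q ∈ Finset.HasAntidiagonal.antidiagonal k, (k.choose q.1 : ENNReal) * KK R S v h q.1 q.2 := by
  have hA : ∀ A : Finset (Fin k), MeasurableSet {x : Fin k → EE d | ∀ i, i ∈ A ↔ dist (x i) v > R} := by
    intro A
    simp only [Set.ofPred_forall]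
    refine MeasurableSet.iInter fun i => ?_
    have : MeasurableSet {x : Fin k → EE d | dist (x i) v > R} :=
      measurableSet_lt measurable_const (by fun_prop)
    by_cases hi : i ∈ A
    · have e : {x : Fin k → EE d | i ∈ A ↔ dist (x i) v > R} = {x | dist (x i) v > R} := by
        ext x; simp [hi]
      rw [e]; exact this
    · have e : {x : Fin k → EE d | i ∈ A ↔ dist (x i) v > R} = {x | dist (x i) v > R}ᶜ := by
        ext x; simp [hi]
      rw [e]; exact this.compl
  have hmeas : ∀ A : Finset (Fin k), Measurable
      ((pkG R S ∩ {x | ∀ i, i ∈ A ↔ dist (x i) v > R}).indicator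
      (fun x : Fin k → EE d => h (nin R v x) (TgG R S v x))) := by
    intro A
    have : (pkG R S ∩ {x | ∀ i, i ∈ A ↔ dist (x i) v > R}).indicator
      (fun x : Fin k → EE d => h (nin R v x) (TgG R S v x)) =
      (pkG R S ∩ {x | ∀ i, i ∈ A ↔ dist (x i) v > R}).indicator
      (fun x : Fin k → EE d => h (Aᶜ.card) (TgG R S v x)) := by
      refine Set.indicator_congr fun x hx => ?_
      have : nin R v x = Aᶜ.card := by
        unfold nin
        congr 1
        ext i
        simp [hx.2 i]
      simp only [this]
    rw [this]
    exact (hh _ _).indicator ((measurableSet_pkG R hS).inter (hA A))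
  have e1 : ∀ x : Fin k → EE d, (pkG R S).indicator (fun x => h (nin R v x) (TgG R S v x)) x =
      ∑ A : Finset (Fin k), (pkG R S ∩ {x | ∀ i, i ∈ A ↔ dist (x i) v > R}).indicator
      (fun x => h (nin R v x) (TgG R S v x)) x := by
    intro x
    rw [Finset.sum_eq_single (Finset.univ.filter fun i => dist (x i) v > R)]
    · by_cases hx : x ∈ pkG R S
      · rw [Set.indicator_of_mem hx, Set.indicator_of_mem]
        exact ⟨hx, by simp⟩
      · rw [Set.indicator_of_notMem hx, Set.indicator_of_notMem]
        exact fun H => hx H.1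
    · intro A _ hne
      rw [Set.indicator_of_notMem]
      intro H
      apply hne
      ext i
      simpa using H.2 i
    · simp
  rw [lintegral_congr e1, lintegral_finsetSum _ fun A _ => hmeas A]
  rw [Finset.sum_congr rfl fun A _ => term_eq R hS v h hh A]
  have := Finset.sum_powerset_apply_card (fun m => KK R S v h m (k - m))
    (x := (Finset.univ : Finset (Fin k)))
  simp only [Finset.powerset_univ, Finset.card_univ, Fintype.card_fin] at this ⊢
  rw [this, Finset.Nat.sum_antidiagonal_eq_sum_range_succ
    (fun m j => (k.choose m : ENNReal) * KK R S v h m j)]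
  simp

/-- coefficient -/
noncomputable def cf (l : ENNReal) (k : ℕ) : ENNReal := l ^ k / (k.factorial : ENNReal)

lemma cf_choose (l : ENNReal) (hl : l ≠ ⊤) (m j : ℕ) :
    cf l (m + j) * ((m + j).choose m : ENNReal) = cf l m * cf l j := by
  unfold cf
  have h : ((m + j).choose m : ENNReal) * m.factorial * j.factorial = (m + j).factorial := by
    have := Nat.add_choose_mul_factorial_mul_factorial m j
    rw [← Nat.choose_symm_add] at this
    exact_mod_cast this
  have hm : (m.factorial : ENNReal) ≠ 0 := by exact_mod_cast m.factorial_ne_zero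
  have hj : (j.factorial : ENNReal) ≠ 0 := by exact_mod_cast j.factorial_ne_zero
  have hmj : ((m + j).factorial : ENNReal) ≠ 0 := by exact_mod_cast (m + j).factorial_ne_zero
  rw [← ENNReal.toReal_eq_toReal_iff']
  · have h' : ((m + j).choose m : ℝ) * m.factorial * j.factorial = (m + j).factorial := by
      have := Nat.add_choose_mul_factorial_mul_factorial m j
      rw [← Nat.choose_symm_add] at this
      exact_mod_cast this
    simp only [ENNReal.toReal_mul, ENNReal.toReal_div, ENNReal.toReal_pow, ENNReal.toReal_natCast]
    have hm : (m.factorial : ℝ) ≠ 0 := by exact_mod_cast m.factorial_ne_zero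
    have hj : (j.factorial : ℝ) ≠ 0 := by exact_mod_cast j.factorial_ne_zero
    have hmj : ((m + j).factorial : ℝ) ≠ 0 := by exact_mod_cast (m + j).factorial_ne_zero
    field_simp
    rw [← h']
    ring
  · exact ENNReal.mul_ne_top (ENNReal.div_ne_top (ENNReal.pow_ne_top hl) hmj) (by simp)
  · exact ENNReal.mul_ne_top (ENNReal.div_ne_top (ENNReal.pow_ne_top hl) hm)
      (ENNReal.div_ne_top (ENNReal.pow_ne_top hl) hj)

lemma tsum_antidiag (f : ℕ → ℕ → ENNReal) :
    ∑' k, ∑ q ∈ Finset.HasAntidiagonal.antidiagonal k, f q.1 q.2 = ∑' m, ∑' j, f m j := by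
  rw [← ENNReal.tsum_prod, ← Finset.HasAntidiagonal.sigmaAntidiagonalEquivProd.tsum_eq, ENNReal.tsum_sigma']
  refine tsum_congr fun k => ?_
  rw [tsum_fintype, ← Finset.sum_attach]
  rfl

/-- spatial Markov, abstract form -/
lemma markov {d : ℕ} (l : ENNReal) (hl : l ≠ ⊤) (R : ℝ) {S : Set (EE d)} (hS : MeasurableSet S)
    (v : EE d) (h : ℕ → Set (EE d) → ENNReal)
    (hh : ∀ (κ : Type) [Fintype κ] (j : ℕ), Measurable fun y : κ → EE d => h j (TgG R S v y)) :
    ∑' k, cf l k * ∫⁻ x : Fin k → EE d, (pkG R S).indicator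
      (fun x => h (nin R v x) (TgG R S v x)) x =
    ∑' m, cf l m * ∫⁻ y : Fin m → EE d, (pkG R (CxG R S v)).indicator
      (fun y => ∑' j, cf l j * (h j (TgG R S v y) * VV R j (TgG R S v y))) y := by
  have e1 : ∀ k, cf l k * ∫⁻ x : Fin k → EE d, (pkG R S).indicator
      (fun x => h (nin R v x) (TgG R S v x)) x =
      ∑ q ∈ Finset.HasAntidiagonal.antidiagonal k, cf l q.1 * (cf l q.2 * KK R S v h q.1 q.2) := by
    intro k
    rw [JJ_eq k R hS v h hh, Finset.mul_sum]
    refine Finset.sum_congr rfl fun q hq => ?_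
    rw [Finset.HasAntidiagonal.mem_antidiagonal] at hq
    subst hq
    rw [← mul_assoc, cf_choose l hl, mul_assoc]
  rw [tsum_congr e1, tsum_antidiag (fun m j => cf l m * (cf l j * KK R S v h m j))]
  refine tsum_congr fun m => ?_
  rw [ENNReal.tsum_mul_left]
  congr 1
  have hm : ∀ j, Measurable ((pkG R (CxG R S v)).indicator
      (fun y : Fin m → EE d => h j (TgG R S v y) * VV R j (TgG R S v y))) := fun j =>
    ((hh _ j).mul (measurable_VV R hS j v)).indicator
      (measurableSet_pkG R (measurableSet_CxG R v hS))
  simp only [KK]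
  simp_rw [← lintegral_const_mul _ (hm _)]
  rw [← lintegral_tsum fun j => ((hm j).const_mul _).aemeasurable]
  congr 1
  ext y
  by_cases hy : y ∈ pkG R (CxG R S v)
  · simp [hy]
  · simp [hy]
noncomputable def WW {d : ℕ} (l : ENNReal) (R : ℝ) (T : Set (EE d)) : ENNReal :=
  ∑' j, cf l j * VV R j T

noncomputable def NN {d : ℕ} (l : ENNReal) (R : ℝ) (T : Set (EE d)) : ENNReal :=
  ∑' j, cf l j * ((j : ENNReal) * VV R j T)

lemma VV_zero {d : ℕ} (R : ℝ) (T : Set (EE d)) : VV R 0 T = 1 := by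
  have : pkG (ι := Fin 0) R T = Set.univ.pi (fun _ => T) := by
    ext x; simp [pkG]
  unfold VV
  rw [this, volume_pi_pi]
  simp

lemma VV_le {d : ℕ} (R : ℝ) (T : Set (EE d)) (j : ℕ) : VV R j T ≤ volume T ^ j := by
  have : pkG (ι := Fin j) R T ⊆ Set.univ.pi (fun _ => T) := by
    intro x hx i _
    exact hx.1 i
  refine (measure_mono this).trans ?_
  rw [volume_pi_pi]
  simp

lemma one_le_WW {d : ℕ} (l : ENNReal) (R : ℝ) (T : Set (EE d)) : 1 ≤ WW l R T := by
  refine le_trans ?_ (ENNReal.le_tsum 0)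
  simp [VV_zero, cf]

lemma tsum_cf_ne_top (a : ENNReal) (ha : a ≠ ⊤) : ∑' j, cf a j ≠ ⊤ := by
  have h := Real.summable_pow_div_factorial a.toReal
  have h2 := h.tsum_ofReal_ne_top
  convert h2 using 3 with j
  unfold cf
  rw [ENNReal.ofReal_div_of_pos (by positivity), ENNReal.ofReal_pow (by positivity),
    ENNReal.ofReal_toReal ha]
  simp

lemma tsum_cf_mul_ne_top (a : ENNReal) (ha : a ≠ ⊤) : ∑' j, cf a j * (j : ENNReal) ≠ ⊤ := by
  refine ne_top_of_le_ne_top (tsum_cf_ne_top (2 * a) (ENNReal.mul_ne_top (by simp) ha)) ?_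
  refine ENNReal.tsum_le_tsum fun j => ?_
  unfold cf
  rw [mul_pow, mul_comm, ← mul_div_assoc]
  gcongr
  exact_mod_cast Nat.lt_two_pow_self.le

lemma WW_ne_top {d : ℕ} (l : ENNReal) (hl : l ≠ ⊤) (R : ℝ) (T : Set (EE d)) (hT : volume T ≠ ⊤) :
    WW l R T ≠ ⊤ := by
  refine ne_top_of_le_ne_top (tsum_cf_ne_top (l * volume T) (ENNReal.mul_ne_top hl hT)) ?_
  refine ENNReal.tsum_le_tsum fun j => ?_
  unfold cf
  rw [mul_pow, ENNReal.mul_div_right_comm]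
  gcongr
  exact VV_le R T j

lemma NN_ne_top {d : ℕ} (l : ENNReal) (hl : l ≠ ⊤) (R : ℝ) (T : Set (EE d)) (hT : volume T ≠ ⊤) :
    NN l R T ≠ ⊤ := by
  refine ne_top_of_le_ne_top (tsum_cf_mul_ne_top (l * volume T) (ENNReal.mul_ne_top hl hT)) ?_
  refine ENNReal.tsum_le_tsum fun j => ?_
  unfold cf
  rw [mul_pow, ENNReal.mul_div_right_comm, mul_comm (j : ENNReal), ← mul_assoc]
  gcongr
  exact VV_le R T j

lemma TgG_subset {d : ℕ} {ι : Type} (R : ℝ) (S : Set (EE d)) (v : EE d) (x : ι → EE d) :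
    TgG R S v x ⊆ S := fun _ hp => hp.1.2

lemma measurable_ratio_joint {d : ℕ} {ι : Type} [Fintype ι] (l : ENNReal) (R : ℝ) {S : Set (EE d)}
    (hS : MeasurableSet S) :
    Measurable (fun q : EE d × (ι → EE d) =>
      NN l R (TgG R S q.1 q.2) / WW l R (TgG R S q.1 q.2)) := by
  refine Measurable.div ?_ ?_
  · exact Measurable.tsum fun j => ((measurable_VV_joint R hS j).const_mul _).const_mul _
  · exact Measurable.tsum fun j => (measurable_VV_joint R hS j).const_mul _

lemma measurable_ratio {d : ℕ} {ι : Type} [Fintype ι] (l : ENNReal) (R : ℝ) {S : Set (EE d)}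
    (hS : MeasurableSet S) (v : EE d) :
    Measurable (fun x : ι → EE d =>
      NN l R (TgG R S v x) / WW l R (TgG R S v x)) := by
  have h1 : Measurable (fun x : ι → EE d => (v, x)) := measurable_prodMk_left
  have h2 := (measurable_ratio_joint (ι := ι) l R hS).comp h1
  simp only [Function.comp_def] at h2
  exact h2

/-- spatial Markov identity for fixed `v` -/
lemma markov_v {d : ℕ} (l : ENNReal) (hl : l ≠ ⊤) (R : ℝ) {S : Set (EE d)} (hS : MeasurableSet S)
    (hf : volume S ≠ ⊤) (v : EE d) :
    ∑' k, cf l k * ∫⁻ x : Fin k → EE d, (pkG R S).indicator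
      (fun x => NN l R (TgG R S v x) / WW l R (TgG R S v x)) x =
    ∑' k, cf l k * ∫⁻ x : Fin k → EE d, (pkG R S).indicator
      (fun x => (nin R v x : ENNReal)) x := by
  have h1 := markov l hl R hS v (fun _ T => NN l R T / WW l R T)
    (fun κ _ j => measurable_ratio l R hS v)
  have h2 := markov l hl R hS v (fun j _ => (j : ENNReal)) (fun κ _ j => measurable_const)
  refine h1.trans (Eq.trans ?_ h2.symm)
  refine tsum_congr fun m => ?_
  congr 1
  refine lintegral_congr fun y => ?_
  refine congrFun (Set.indicator_congr fun y _ => ?_) y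
  have hT : volume (TgG R S v y) ≠ ⊤ := ne_top_of_le_ne_top hf (measure_mono (TgG_subset R S v y))
  have hw0 : WW l R (TgG R S v y) ≠ 0 := (lt_of_lt_of_le one_pos (one_le_WW l R _)).ne'
  have hwt := WW_ne_top l hl R _ hT
  have e : ∀ j, cf l j * (NN l R (TgG R S v y) / WW l R (TgG R S v y) * VV R j (TgG R S v y)) =
      (NN l R (TgG R S v y) / WW l R (TgG R S v y)) * (cf l j * VV R j (TgG R S v y)) := by
    intro j; ring
  rw [tsum_congr e, ENNReal.tsum_mul_left]
  show NN l R (TgG R S v y) / WW l R (TgG R S v y) * WW l R (TgG R S v y) = NN l R (TgG R S v y)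
  exact ENNReal.div_mul_cancel hw0 hwt

/-- the main inequality, in `ENNReal` -/
lemma main_ennreal {d : ℕ} (l : ENNReal) (hl : l ≠ ⊤) (R : ℝ) {S : Set (EE d)}
    (hS : MeasurableSet S) (hf : volume S ≠ ⊤) (D : ENNReal)
    (hD : ∀ x : EE d, volume (Metric.closedBall x R) ≤ D) :
    ∑' k, cf l k * ∫⁻ v in S, ∫⁻ x : Fin k → EE d, (pkG R S).indicator
      (fun x => NN l R (TgG R S v x) / WW l R (TgG R S v x)) x ≤ D * NN l R S := by
  have hind : ∀ k, MeasurableSet {q : EE d × (Fin k → EE d) | q.2 ∈ pkG R S} := fun k =>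
    measurable_snd (measurableSet_pkG R hS)
  have hm : ∀ k, Measurable fun v => ∫⁻ x : Fin k → EE d, (pkG R S).indicator
      (fun x => NN l R (TgG R S v x) / WW l R (TgG R S v x)) x := by
    intro k
    exact ((measurable_ratio_joint l R hS).indicator (hind k)).lintegral_prod_right'
  have hB : ∀ k (i : Fin k), MeasurableSet {q : EE d × (Fin k → EE d) | dist (q.2 i) q.1 ≤ R} :=
    fun k i => measurableSet_le (by fun_prop) measurable_const
  have hnin : ∀ k (v : EE d) (x : Fin k → EE d), (nin R v x : ENNReal) =
      ∑ i, {q : EE d × (Fin k → EE d) | dist (q.2 i) q.1 ≤ R}.indicator 1 (v, x) := by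
    classical
    intro k v x
    unfold nin
    rw [Finset.card_filter]
    push_cast
    refine Finset.sum_congr rfl fun i _ => ?_
    simp [Set.indicator, not_lt]
  have hmn : ∀ k, Measurable fun q : EE d × (Fin k → EE d) => (nin R q.1 q.2 : ENNReal) := by
    intro k
    simp_rw [hnin]
    exact Finset.measurable_sum _ fun i _ => measurable_one.indicator (hB k i)
  have hmi : ∀ k, Measurable (fun q : EE d × (Fin k → EE d) =>
      (pkG R S).indicator (fun x => (nin R q.1 x : ENNReal)) q.2) := fun k =>
    (hmn k).indicator (hind k)
  have hmn' : ∀ k, Measurable fun v => ∫⁻ x : Fin k → EE d, (pkG R S).indicator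
      (fun x => (nin R v x : ENNReal)) x := fun k => (hmi k).lintegral_prod_right'
  simp_rw [← lintegral_const_mul _ (hm _)]
  rw [← lintegral_tsum fun k => ((hm k).const_mul _).aemeasurable]
  simp_rw [markov_v l hl R hS hf]
  rw [lintegral_tsum fun k => ((hmn' k).const_mul _).aemeasurable]
  simp_rw [lintegral_const_mul _ (hmn' _)]
  unfold NN
  rw [← ENNReal.tsum_mul_left]
  refine ENNReal.tsum_le_tsum fun k => ?_
  rw [mul_left_comm]
  gcongr
  rw [lintegral_lintegral_swap (hmi k).aemeasurable]
  have hb : ∀ x : Fin k → EE d, ∫⁻ v in S, (pkG R S).indicator (fun x => (nin R v x : ENNReal)) x ≤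
      (pkG R S).indicator (fun _ => D * k) x := by
    intro x
    by_cases hx : x ∈ pkG R S
    · simp only [hx, Set.indicator_of_mem]
      refine (lintegral_mono' Measure.restrict_le_self le_rfl).trans ?_
      have e : ∀ v, (nin R v x : ENNReal) = ∑ i, (Metric.closedBall (x i) R).indicator 1 v := by
        intro v
        rw [hnin]
        refine Finset.sum_congr rfl fun i _ => ?_
        simp [Set.indicator, dist_comm]
      simp_rw [e]
      rw [lintegral_finsetSum _ fun i _ => measurable_one.indicator measurableSet_closedBall]
      simp_rw [lintegral_indicator_one (measurableSet_closedBall)]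
      refine (Finset.sum_le_sum fun i _ => hD (x i)).trans ?_
      simp [mul_comm]
    · simp [hx]
  refine (lintegral_mono hb).trans ?_
  rw [lintegral_indicator (measurableSet_pkG R hS), lintegral_const]
  simp [VV, mul_assoc]

lemma vol_ball (d : ℕ) (x : EE d) :
    volume (Metric.closedBall x (2 * rd d)) ≤ ENNReal.ofReal ((2 : ℝ) ^ d) := by
  have hr : 0 ≤ rd d := by unfold rd; positivity
  rw [Measure.addHaar_closedBall _ _ (by positivity), mul_pow,
    ENNReal.ofReal_mul (by positivity), mul_assoc]
  refine le_trans (b := ENNReal.ofReal ((2 : ℝ) ^ Module.finrank ℝ (EE d)) * 1) ?_ (by simp)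
  gcongr
  rw [← Measure.addHaar_closedBall _ (0 : EE d) hr]
  have h1 : volume (Metric.closedBall (0 : EE d) 1) = volume (Metric.ball (0 : EE d) 1) := by
    rw [Measure.addHaar_closedBall _ _ zero_le_one]
    simp
  rw [Measure.addHaar_closedBall _ _ hr, ← h1]
  set V := volume (Metric.closedBall (0 : EE d) 1) with hV
  have hVt : V ≠ ⊤ := measure_closedBall_lt_top.ne
  have hV0 : 0 < V := Metric.measure_closedBall_pos _ _ one_pos
  have hVp : 0 < V.toReal := ENNReal.toReal_pos hV0.ne' hVt
  have hfr : Module.finrank ℝ (EE d) = d := by simp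
  rw [hfr]
  rcases Nat.eq_zero_or_pos d with rfl | hd
  · have : V ≤ 1 := by
      rw [hV, volume_euclideanSpace_eq_dirac]
      exact prob_le_one
    simpa using this
  · have : rd d ^ d = V.toReal⁻¹ := by
      unfold rd
      rw [← Real.rpow_natCast, ← Real.rpow_mul hVp.le]
      have : (-(1 : ℝ) / d) * d = -1 := by field_simp
      rw [this, Real.rpow_neg_one]
    rw [this, ENNReal.ofReal_inv_of_pos hVp, ENNReal.ofReal_toReal hVt,
      ENNReal.inv_mul_cancel hV0.ne' hVt]

lemma coeff_eq {d : ℕ} {lam : ℝ} (hlam : 0 < lam) {T : Set (EE d)} (hT : MeasurableSet T)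
    (hTf : volume T ≠ ⊤) (k : ℕ) :
    ENNReal.ofReal (lam ^ k * Zhat d T k) = cf (ENNReal.ofReal lam) k * VV (2 * rd d) k T := by
  have hVt : VV (2 * rd d) k T ≠ ⊤ := ne_top_of_le_ne_top (ENNReal.pow_ne_top hTf) (VV_le _ T k)
  have h1 : Zhat d T k = (1 / (Nat.factorial k : ℝ)) * (VV (2 * rd d) k T).toReal := by
    unfold Zhat
    congr 1
    have hp : packSet d k T = pkG (2 * rd d) T := rfl
    rw [hp, integral_indicator (measurableSet_pkG _ hT)]
    simp [VV, Measure.real]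
  rw [h1, ← mul_assoc, ENNReal.ofReal_mul (by positivity), ENNReal.ofReal_toReal hVt]
  congr 1
  unfold cf
  rw [mul_one_div, ENNReal.ofReal_div_of_pos (by positivity), ENNReal.ofReal_pow hlam.le]
  simp

lemma Zhat_nonneg (d : ℕ) (T : Set (EE d)) (k : ℕ) : 0 ≤ Zhat d T k := by
  unfold Zhat
  refine mul_nonneg (by positivity) (integral_nonneg fun x => ?_)
  exact Set.indicator_nonneg (fun _ _ => zero_le_one) x

lemma Zgc_eq {d : ℕ} {lam : ℝ} (hlam : 0 < lam) {T : Set (EE d)} (hT : MeasurableSet T)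
    (hTf : volume T ≠ ⊤) :
    Zgc d T lam = (WW (ENNReal.ofReal lam) (2 * rd d) T).toReal := by
  unfold Zgc WW
  simp_rw [← coeff_eq hlam hT hTf]
  rw [ENNReal.tsum_toReal_eq (fun _ => ENNReal.ofReal_ne_top)]
  refine tsum_congr fun k => ?_
  rw [ENNReal.toReal_ofReal (mul_nonneg (by positivity) (Zhat_nonneg d T k))]

lemma Nsum_eq {d : ℕ} {lam : ℝ} (hlam : 0 < lam) {T : Set (EE d)} (hT : MeasurableSet T)
    (hTf : volume T ≠ ⊤) :
    ∑' k : ℕ, (k : ℝ) * lam ^ k * Zhat d T k = (NN (ENNReal.ofReal lam) (2 * rd d) T).toReal := by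
  unfold NN
  have e : ∀ k : ℕ, cf (ENNReal.ofReal lam) k * ((k : ENNReal) * VV (2 * rd d) k T) =
      (k : ENNReal) * ENNReal.ofReal (lam ^ k * Zhat d T k) := fun k => by
    rw [coeff_eq hlam hT hTf, mul_left_comm]
  rw [tsum_congr e]
  rw [ENNReal.tsum_toReal_eq
    (fun _ => ENNReal.mul_ne_top (ENNReal.natCast_ne_top _) ENNReal.ofReal_ne_top)]
  refine tsum_congr fun k => ?_
  rw [ENNReal.toReal_mul, ENNReal.toReal_ofReal (mul_nonneg (by positivity) (Zhat_nonneg d T k))]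
  simp [mul_assoc]

/-- `α_S(λ) ≥ 2^{-d} E[λ Z'_{T(v,X)}(λ) / Z_{T(v,X)}(λ)]`, the expectation
over the two-part experiment. -/
theorem alphaS_ge_exp_occupancy_T (d : ℕ) (S : Set (EuclideanSpace ℝ (Fin d)))
    (hB : Bornology.IsBounded S) (hM : MeasurableSet S) (hv : 0 < volume S)
    (lam : ℝ) (hlam : 0 < lam) :
    alphaS d S lam ≥
      (2 : ℝ) ^ (-(d : ℝ)) * ExpT d S lam (fun v _k x =>
        (∑' j : ℕ, (j : ℝ) * lam ^ j * Zhat d (Treg d S v x) j)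
          / Zgc d (Treg d S v x) lam) := by
  have hf : volume S ≠ ⊤ := hB.measure_lt_top.ne
  set l := ENNReal.ofReal lam with hl
  have hlt : l ≠ ⊤ := ENNReal.ofReal_ne_top
  have hmain := main_ennreal l hlt (2 * rd d) hM hf _ (vol_ball d)
  unfold alphaS ExpT
  rw [Nsum_eq hlam hM hf]
  have hNt := NN_ne_top l hlt (2 * rd d) S hf
  set A := ∑' k : ℕ, (lam ^ k / (Nat.factorial k : ℝ)) *
      ∫ v in S, ∫ x : Fin k → EuclideanSpace ℝ (Fin d),
        Set.indicator (packSet d k S) (fun y => (∑' j : ℕ, (j : ℝ) * lam ^ j * Zhat d (Treg d S v y) j)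
          / Zgc d (Treg d S v y) lam) x with hA
  have key : ‖A‖ₑ ≤ ENNReal.ofReal ((2 : ℝ) ^ d) * NN l (2 * rd d) S := by
    refine le_trans ?_ hmain
    refine enorm_tsum_le_tsum_enorm.trans (ENNReal.tsum_le_tsum fun k => ?_)
    rw [enorm_mul]
    have hc : ‖lam ^ k / (Nat.factorial k : ℝ)‖ₑ = cf l k := by
      rw [Real.enorm_of_nonneg (by positivity), ENNReal.ofReal_div_of_pos (by positivity),
        ENNReal.ofReal_pow hlam.le]
      simp [cf, hl]
    rw [hc]
    gcongr
    refine (enorm_integral_le_lintegral_enorm _).trans (lintegral_mono fun v => ?_)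
    refine (enorm_integral_le_lintegral_enorm _).trans (lintegral_mono fun x => ?_)
    have hp : packSet d k S = pkG (2 * rd d) S := rfl
    rw [hp]
    by_cases hx : x ∈ pkG (2 * rd d) S
    · rw [Set.indicator_of_mem hx, Set.indicator_of_mem hx]
      have ht : Treg d S v x = TgG (2 * rd d) S v x := rfl
      have hTm := measurableSet_TgG (2 * rd d) hM v x
      have hT : volume (TgG (2 * rd d) S v x) ≠ ⊤ :=
        ne_top_of_le_ne_top hf (measure_mono (TgG_subset _ S v x))
      rw [ht, Nsum_eq hlam hTm hT, Zgc_eq hlam hTm hT, ← ENNReal.toReal_div,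
        Real.enorm_of_nonneg ENNReal.toReal_nonneg]
      exact ENNReal.ofReal_toReal_le
    · rw [Set.indicator_of_notMem hx, Set.indicator_of_notMem hx]
      simp
  have hAle : A ≤ 2 ^ d * (NN l (2 * rd d) S).toReal := by
    have h1 := ENNReal.toReal_mono (ENNReal.mul_ne_top ENNReal.ofReal_ne_top hNt) key
    rw [ENNReal.toReal_mul, ENNReal.toReal_ofReal (by positivity), toReal_enorm] at h1
    exact (le_abs_self A).trans h1
  have hZ : 0 ≤ Zgc d S lam := by
    rw [Zgc_eq hlam hM hf]; exact ENNReal.toReal_nonneg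
  have hden : 0 ≤ 1 / ((volume S).toReal * Zgc d S lam) := by positivity
  rw [ge_iff_le, Real.rpow_neg (by norm_num), Real.rpow_natCast]
  rw [div_eq_mul_one_div (NN (ENNReal.ofReal lam) (2 * rd d) S).toReal, mul_left_comm,
    mul_comm (1 / ((volume S).toReal * Zgc d S lam))]
  refine mul_le_mul_of_nonneg_right ?_ hden
  rw [inv_mul_le_iff₀ (by positivity)]
  exact hAle
end
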